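/- Bound preservation in the limit: define h(μ) := Σ_q μ(∘, q) · q + Σ_{(v, q) : v ≠ ∘} μ(v, q) · (Φ(v) + q). Let μ₁ ⊑ μ₂ ⊑ ⋯ ⊑ μₙ ⊑ ⋯ be a chain of distributions and let M ∈ ℝ≥0. If h(μₙ) ≤ M for all n ∈ ℕ, then h(⊔_{n∈ℕ} μₙ) ≤ M. -/

import Mathlib

set_option maxHeartbeats 1000000

open scoped ENNReal NNRat NNReal
open Classical

noncomputable section

/-- Probability mass functions on `(Val ∪ {∘}) × (ℚ≥0 ∪ {∞})`, where the dummy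
value `∘` (represented by `none`) stands for partial (unfinished) evaluation. -/
abbrev PDist (Val : Type*) : Type _ := Option Val × WithTop ℚ≥0 → ℝ≥0∞

/-- `μ` is a (full) probability distribution: its total mass is `1`. -/
def IsDist {Val : Type*} (μ : PDist Val) : Prop :=
  ∑' a : Option Val × WithTop ℚ≥0, μ a = 1

/-- The order `⊑`: `μ₁ ⊑ μ₂` iff (i) `μ₁(v, q) ≤ μ₂(v, q)` for all `v ≠ ∘` and
all `q`, and (ii) `μ₁((Val ∪ {∘}) × [0, q]) ≥ μ₂((Val ∪ {∘}) × [0, q])` for all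
`q ∈ ℚ≥0 ∪ {∞}`. -/
def DLE {Val : Type*} (μ₁ μ₂ : PDist Val) : Prop :=
  (∀ (v : Val) (c : WithTop ℚ≥0), μ₁ (some v, c) ≤ μ₂ (some v, c)) ∧
  (∀ c : WithTop ℚ≥0,
    (∑' a : Option Val × WithTop ℚ≥0,
        Set.indicator {a : Option Val × WithTop ℚ≥0 | a.2 ≤ c} μ₂ a) ≤
      ∑' a : Option Val × WithTop ℚ≥0,
        Set.indicator {a : Option Val × WithTop ℚ≥0 | a.2 ≤ c} μ₁ a)

/-- Embedding of costs `ℚ≥0 ∪ {∞}` into the extended nonnegative reals. -/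
def costE : WithTop ℚ≥0 → ℝ≥0∞ :=
  WithTop.recTopCoe ⊤ fun q => ((q : ℝ≥0) : ℝ≥0∞)

/-- `h(μ) = Σ_q μ(∘, q)·q + Σ_{(v, q) : v ≠ ∘} μ(v, q)·(Φ(v) + q)`,
computed in the extended nonnegative reals. -/
def hFn {Val : Type*} (Φ : Val → ℝ≥0) (μ : PDist Val) : ℝ≥0∞ :=
  (∑' c : WithTop ℚ≥0, μ (none, c) * costE c) +
    ∑' a : Val × WithTop ℚ≥0, μ (some a.1, a.2) * ((Φ a.1 : ℝ≥0∞) + costE a.2)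

/-- Monotone convergence for sums in the extended nonnegative reals. -/
theorem tsum_iSup_of_monotone {α : Type*} {f : α → ℕ → ℝ≥0∞} (hf : ∀ a, Monotone (f a)) :
    ∑' a, ⨆ n, f a n = ⨆ n, ∑' a, f a n := by
  simp only [ENNReal.tsum_eq_iSup_sum]
  rw [iSup_comm]
  exact iSup_congr fun s => ENNReal.finsetSum_iSup_of_monotone hf

theorem tsum_option_prod {α β : Type*} (f : Option α × β → ℝ≥0∞) :
    ∑' a, f a = (∑' b, f (none, b)) + ∑' p : α × β, f (some p.1, p.2) := by
  rw [ENNReal.tsum_prod', ENNReal.tsum_eq_add_tsum_ite none,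
    ENNReal.tsum_prod (f := fun a b => f (some a, b))]
  congr 1
  rw [← (Option.some_injective α).tsum_eq]
  · simp
  · rintro (_ | a) h
    · simp at h
    · exact ⟨a, rfl⟩

section

variable {Val : Type*}

/-- The mass of the outcomes of cost at most `c`. -/
def cdf (μ : PDist Val) (c : WithTop ℚ≥0) : ℝ≥0∞ :=
  ∑' a : Option Val × WithTop ℚ≥0,
    Set.indicator {a : Option Val × WithTop ℚ≥0 | a.2 ≤ c} μ a

/-- The mass of the outcomes of cost greater than `c`. -/
def tail (μ : PDist Val) (c : WithTop ℚ≥0) : ℝ≥0∞ :=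
  ∑' a : Option Val × WithTop ℚ≥0, if c < a.2 then μ a else 0

/-- The part of `cdf` carried by proper values. -/
def valCdf (μ : PDist Val) (c : WithTop ℚ≥0) : ℝ≥0∞ :=
  ∑' p : Val × WithTop ℚ≥0, if p.2 ≤ c then μ (some p.1, p.2) else 0

/-- The part of `cdf` carried by the dummy value. -/
def dummyCdf (μ : PDist Val) (c : WithTop ℚ≥0) : ℝ≥0∞ :=
  ∑' d : WithTop ℚ≥0, if d ≤ c then μ (none, d) else 0

/-- The expected potential. -/
def potential (Φ : Val → ℝ≥0) (μ : PDist Val) : ℝ≥0∞ :=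
  ∑' a : Val × WithTop ℚ≥0, μ (some a.1, a.2) * (Φ a.1 : ℝ≥0∞)

theorem cdf_eq (μ : PDist Val) (c : WithTop ℚ≥0) : cdf μ c = dummyCdf μ c + valCdf μ c := by
  rw [cdf, tsum_option_prod]
  simp only [Set.indicator_apply, Set.mem_ofPred_eq]
  rfl

theorem cdf_top (μ : PDist Val) : cdf μ ⊤ = ∑' a, μ a := by
  simp [cdf]

theorem tail_add_cdf {μ : PDist Val} (hμ : IsDist μ) (c : WithTop ℚ≥0) :
    tail μ c + cdf μ c = 1 := by
  rw [tail, cdf, ← ENNReal.tsum_add, ← hμ]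
  refine tsum_congr fun a => ?_
  rcases lt_or_ge c a.2 with h | h
  · simp [h]
  · simp [h, h.not_gt]

theorem cdf_le_one {μ : PDist Val} (hμ : IsDist μ) (c : WithTop ℚ≥0) : cdf μ c ≤ 1 :=
  tail_add_cdf hμ c ▸ le_add_self

theorem tail_eq {μ : PDist Val} (hμ : IsDist μ) (c : WithTop ℚ≥0) : tail μ c = 1 - cdf μ c :=
  ENNReal.eq_sub_of_add_eq ((cdf_le_one hμ c).trans_lt ENNReal.one_lt_top).ne (tail_add_cdf hμ c)

theorem tail_mono {μ ν : PDist Val} (hμ : IsDist μ) (hν : IsDist ν) (h : DLE μ ν)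
    (c : WithTop ℚ≥0) : tail μ c ≤ tail ν c := by
  rw [tail_eq hμ, tail_eq hν]
  exact tsub_le_tsub_left (h.2 c) 1

theorem DLE.refl (μ : PDist Val) : DLE μ μ :=
  ⟨fun _ _ => le_rfl, fun _ => le_rfl⟩

theorem DLE.trans {μ₁ μ₂ μ₃ : PDist Val} (h₁ : DLE μ₁ μ₂) (h₂ : DLE μ₂ μ₃) : DLE μ₁ μ₃ :=
  ⟨fun v c => (h₁.1 v c).trans (h₂.1 v c), fun c => (h₂.2 c).trans (h₁.2 c)⟩

theorem DLE.of_chain {μs : ℕ → PDist Val} (hchain : ∀ n, DLE (μs n) (μs (n + 1)))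
    {m n : ℕ} (h : m ≤ n) : DLE (μs m) (μs n) := by
  induction n, h using Nat.le_induction with
  | base => exact DLE.refl _
  | succ n _ ih => exact ih.trans (hchain n)

theorem potential_mono (Φ : Val → ℝ≥0) {μ ν : PDist Val}
    (h : ∀ v c, μ (some v, c) ≤ ν (some v, c)) : potential Φ μ ≤ potential Φ ν :=
  ENNReal.tsum_le_tsum fun a => mul_le_mul_left (h a.1 a.2) _

theorem potential_iSup (Φ : Val → ℝ≥0) {μs : ℕ → PDist Val}
    (hchain : ∀ n, DLE (μs n) (μs (n + 1))) :
    potential Φ (fun a => ⨆ n, μs n a) = ⨆ n, potential Φ (μs n) := by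
  simp only [potential, ENNReal.iSup_mul]
  exact tsum_iSup_of_monotone fun a m n h =>
    mul_le_mul_left ((DLE.of_chain hchain h).1 a.1 a.2) _

theorem valCdf_iSup {μs : ℕ → PDist Val} (hchain : ∀ n, DLE (μs n) (μs (n + 1)))
    (c : WithTop ℚ≥0) : valCdf (fun a => ⨆ n, μs n a) c = ⨆ n, valCdf (μs n) c := by
  simp only [valCdf]
  rw [← tsum_iSup_of_monotone]
  · refine tsum_congr fun p => ?_
    split_ifs <;> simp
  · intro p m n h
    dsimp only
    split_ifs
    · exact (DLE.of_chain hchain h).1 p.1 p.2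
    · exact le_rfl

theorem dummyCdf_mono (μ : PDist Val) : Monotone (dummyCdf μ) := fun c d h =>
  ENNReal.tsum_le_tsum fun x => by
    by_cases hx : x ≤ c
    · simp [hx, hx.trans h]
    · simp [hx]

/-- Along a chain, the limits of the two parts of the distribution functions add up to the limit
of the distribution functions. -/
theorem iInf_dummyCdf_add_valCdf {μs : ℕ → PDist Val} (hchain : ∀ n, DLE (μs n) (μs (n + 1)))
    (c : WithTop ℚ≥0) :
    (⨅ n, dummyCdf (μs n) c) + valCdf (fun a => ⨆ n, μs n a) c = ⨅ n, cdf (μs n) c := by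
  apply le_antisymm
  · refine le_iInf fun m => ?_
    rw [valCdf_iSup hchain, ENNReal.add_iSup]
    refine iSup_le fun n => ?_
    have hval : valCdf (μs n) c ≤ valCdf (μs (max m n)) c :=
      ENNReal.tsum_le_tsum fun p => by
        split_ifs
        · exact (DLE.of_chain hchain (le_max_right m n)).1 p.1 p.2
        · exact le_rfl
    calc (⨅ k, dummyCdf (μs k) c) + valCdf (μs n) c
        ≤ dummyCdf (μs (max m n)) c + valCdf (μs (max m n)) c :=
          add_le_add (iInf_le (fun k => dummyCdf (μs k) c) _) hval
      _ = cdf (μs (max m n)) c := (cdf_eq _ _).symm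
      _ ≤ cdf (μs m) c := (DLE.of_chain hchain (le_max_left m n)).2 c
  · rw [ENNReal.iInf_add]
    refine iInf_mono fun n => ?_
    rw [cdf_eq, valCdf_iSup hchain]
    exact add_le_add_right (le_iSup (fun n => valCdf (μs n) c) n) _

/-- An upper bound of the chain `μs`: the mass of the proper values is the limit of the chain, and
the remaining mass is split between the costs `q` and `∞`. -/
def upperBound (μs : ℕ → PDist Val) (q : WithTop ℚ≥0) : PDist Val
  | (some v, c) => ⨆ n, μs n (some v, c)
  | (none, c) => (if c = q then ⨅ n, dummyCdf (μs n) q else 0) +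
      if c = ⊤ then (⨅ n, dummyCdf (μs n) ⊤) - ⨅ n, dummyCdf (μs n) q else 0

theorem dummyCdf_upperBound (μs : ℕ → PDist Val) (q c : WithTop ℚ≥0) :
    dummyCdf (upperBound μs q) c = (if q ≤ c then ⨅ n, dummyCdf (μs n) q else 0) +
      if c = ⊤ then (⨅ n, dummyCdf (μs n) ⊤) - ⨅ n, dummyCdf (μs n) q else 0 := by
  have h : ∀ d, (if d ≤ c then upperBound μs q (none, d) else 0) =
      (if d = q then (if q ≤ c then ⨅ n, dummyCdf (μs n) q else 0) else 0) +
      if d = ⊤ then (if c = ⊤ then (⨅ n, dummyCdf (μs n) ⊤) - ⨅ n, dummyCdf (μs n) q else 0)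
        else 0 := by
    intro d
    by_cases hd : d ≤ c
    · rw [if_pos hd, upperBound]
      congr 1
      · split_ifs with h₁ h₂
        · rfl
        · exact absurd (h₁ ▸ hd) h₂
        · rfl
      · split_ifs with h₁ h₂
        · rfl
        · exact absurd (top_le_iff.mp (h₁ ▸ hd)) h₂
        · rfl
    · rw [if_neg hd]
      have h₁ : d = q → ¬ q ≤ c := fun h => h ▸ hd
      have h₂ : c ≠ ⊤ := fun h => hd (h ▸ le_top)
      by_cases hq : d = q <;> simp [hq, h₂]
      simpa using fun h => absurd h (h₁ hq)
  rw [dummyCdf, tsum_congr h, ENNReal.tsum_add, tsum_ite_eq, tsum_ite_eq]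

theorem cdf_upperBound (μs : ℕ → PDist Val) (q c : WithTop ℚ≥0) :
    cdf (upperBound μs q) c =
      dummyCdf (upperBound μs q) c + valCdf (fun a => ⨆ n, μs n a) c :=
  cdf_eq _ _

theorem iInf_dummyCdf_mono (μs : ℕ → PDist Val) : Monotone fun c => ⨅ n, dummyCdf (μs n) c :=
  fun _ _ h => iInf_mono fun n => dummyCdf_mono (μs n) h

theorem dummyCdf_upperBound_top (μs : ℕ → PDist Val) (q : WithTop ℚ≥0) :
    dummyCdf (upperBound μs q) ⊤ = ⨅ n, dummyCdf (μs n) ⊤ := by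
  rw [dummyCdf_upperBound, if_pos le_top, if_pos rfl]
  exact add_tsub_cancel_of_le (iInf_dummyCdf_mono μs le_top)

theorem dummyCdf_upperBound_le (μs : ℕ → PDist Val) (q c : WithTop ℚ≥0) :
    dummyCdf (upperBound μs q) c ≤ ⨅ n, dummyCdf (μs n) c := by
  by_cases hc : c = ⊤
  · rw [hc, dummyCdf_upperBound_top]
  · rw [dummyCdf_upperBound, if_neg hc, add_zero]
    split_ifs with h
    · exact iInf_dummyCdf_mono μs h
    · exact zero_le

theorem isDist_upperBound {μs : ℕ → PDist Val} (hdist : ∀ n, IsDist (μs n))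
    (hchain : ∀ n, DLE (μs n) (μs (n + 1))) (q : WithTop ℚ≥0) : IsDist (upperBound μs q) := by
  have h : ∀ n, cdf (μs n) ⊤ = 1 := fun n => (cdf_top _).trans (hdist n)
  rw [IsDist, ← cdf_top, cdf_upperBound, dummyCdf_upperBound_top,
    iInf_dummyCdf_add_valCdf hchain]
  simp [h]

theorem DLE_upperBound {μs : ℕ → PDist Val} (hchain : ∀ n, DLE (μs n) (μs (n + 1)))
    (q : WithTop ℚ≥0) (n : ℕ) : DLE (μs n) (upperBound μs q) := by
  refine ⟨fun v c => le_iSup (fun n => μs n (some v, c)) n, fun c => ?_⟩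
  calc cdf (upperBound μs q) c
      ≤ (⨅ n, dummyCdf (μs n) c) + valCdf (fun a => ⨆ n, μs n a) c := by
        rw [cdf_upperBound]
        exact add_le_add_left (dummyCdf_upperBound_le μs q c) _
    _ = ⨅ n, cdf (μs n) c := iInf_dummyCdf_add_valCdf hchain c
    _ ≤ cdf (μs n) c := iInf_le _ n

theorem le_iSup_of_lub {μs : ℕ → PDist Val} {μ : PDist Val} (hdist : ∀ n, IsDist (μs n))
    (hchain : ∀ n, DLE (μs n) (μs (n + 1)))
    (hlub : ∀ ν : PDist Val, IsDist ν → (∀ n, DLE (μs n) ν) → DLE μ ν)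
    (v : Val) (c : WithTop ℚ≥0) : μ (some v, c) ≤ ⨆ n, μs n (some v, c) :=
  (hlub _ (isDist_upperBound hdist hchain ⊤) (DLE_upperBound hchain ⊤)).1 v c

theorem iInf_cdf_le_of_lub {μs : ℕ → PDist Val} {μ : PDist Val} (hdist : ∀ n, IsDist (μs n))
    (hchain : ∀ n, DLE (μs n) (μs (n + 1)))
    (hlub : ∀ ν : PDist Val, IsDist ν → (∀ n, DLE (μs n) ν) → DLE μ ν)
    (q : WithTop ℚ≥0) : ⨅ n, cdf (μs n) q ≤ cdf μ q := by
  refine le_trans ?_ ((hlub _ (isDist_upperBound hdist hchain q) (DLE_upperBound hchain q)).2 q)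
  change _ ≤ cdf (upperBound μs q) q
  rw [cdf_upperBound, ← iInf_dummyCdf_add_valCdf hchain, dummyCdf_upperBound, if_pos le_rfl]
  exact add_le_add_left le_self_add _

theorem tail_le_iSup_of_lub {μs : ℕ → PDist Val} {μ : PDist Val} (hdist : ∀ n, IsDist (μs n))
    (hchain : ∀ n, DLE (μs n) (μs (n + 1))) (hμ : IsDist μ)
    (hlub : ∀ ν : PDist Val, IsDist ν → (∀ n, DLE (μs n) ν) → DLE μ ν)
    (q : WithTop ℚ≥0) : tail μ q ≤ ⨆ n, tail (μs n) q := by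
  simp only [tail_eq hμ, fun n => tail_eq (hdist n)]
  rw [← ENNReal.sub_iInf]
  exact tsub_le_tsub_left (iInf_cdf_le_of_lub hdist hchain hlub q) 1

theorem hFn_eq (Φ : Val → ℝ≥0) (μ : PDist Val) :
    hFn Φ μ = potential Φ μ + ∑' a, μ a * costE a.2 := by
  rw [tsum_option_prod, hFn, potential]
  simp only [mul_add, ENNReal.tsum_add]
  exact add_left_comm _ _ _

/-- The sum of the steps of the grid `ε ℕ` below a finite cost, as the cost rounded up. -/
theorem tsum_grid_coe {ε : ℚ≥0} (hε : 0 < ε) (q : ℚ≥0) :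
    (∑' i : ℕ, if ((i * ε : ℚ≥0) : WithTop ℚ≥0) < q then ((ε : ℝ≥0) : ℝ≥0∞) else 0) =
      (((⌈q / ε⌉₊ * ε : ℚ≥0) : ℝ≥0) : ℝ≥0∞) := by
  have h : ∀ i : ℕ, ((i * ε : ℚ≥0) : WithTop ℚ≥0) < q ↔ i ∈ Finset.range ⌈q / ε⌉₊ := fun i => by
    rw [WithTop.coe_lt_coe, Finset.mem_range, Nat.lt_ceil, lt_div_iff₀ hε]
  simp only [h]
  rw [tsum_eq_sum (s := Finset.range ⌈q / ε⌉₊) fun i hi => if_neg hi,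
    Finset.sum_congr rfl fun i hi => if_pos hi]
  simp

theorem tsum_grid_top {ε : ℚ≥0} (hε : 0 < ε) :
    (∑' i : ℕ, if ((i * ε : ℚ≥0) : WithTop ℚ≥0) < ⊤ then ((ε : ℝ≥0) : ℝ≥0∞) else 0) = ⊤ := by
  simp only [WithTop.coe_lt_top, if_true]
  exact ENNReal.tsum_const_eq_top_of_ne_zero (by simpa using hε.ne')

theorem costE_le_grid {ε : ℚ≥0} (hε : 0 < ε) (c : WithTop ℚ≥0) :
    costE c ≤ ∑' i : ℕ, if ((i * ε : ℚ≥0) : WithTop ℚ≥0) < c then ((ε : ℝ≥0) : ℝ≥0∞) else 0 := by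
  induction c using WithTop.recTopCoe with
  | top => rw [tsum_grid_top hε]; exact le_top
  | coe q =>
    rw [tsum_grid_coe hε]
    have : q ≤ ⌈q / ε⌉₊ * ε := (div_le_iff₀ hε).mp (Nat.le_ceil _)
    exact ENNReal.coe_le_coe.mpr (NNRat.cast_mono this)

theorem grid_le_costE {ε : ℚ≥0} (hε : 0 < ε) (c : WithTop ℚ≥0) :
    (∑' i : ℕ, if ((i * ε : ℚ≥0) : WithTop ℚ≥0) < c then ((ε : ℝ≥0) : ℝ≥0∞) else 0) ≤
      costE c + ((ε : ℝ≥0) : ℝ≥0∞) := by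
  induction c using WithTop.recTopCoe with
  | top => simp [costE]
  | coe q =>
    rw [tsum_grid_coe hε]
    have : ⌈q / ε⌉₊ * ε ≤ q + ε := by
      calc ⌈q / ε⌉₊ * ε ≤ (q / ε + 1) * ε := by
            gcongr
            exact (Nat.ceil_lt_add_one zero_le).le
        _ = q + ε := by field_simp
    change _ ≤ ((q : ℝ≥0) : ℝ≥0∞) + _
    rw [← ENNReal.coe_add, ← NNRat.cast_add]
    exact ENNReal.coe_le_coe.mpr (NNRat.cast_mono this)

theorem tsum_tail_mul (μ : PDist Val) (ε : ℚ≥0) :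
    ∑' i : ℕ, tail μ ((i * ε : ℚ≥0) : WithTop ℚ≥0) * ((ε : ℝ≥0) : ℝ≥0∞) =
      ∑' a, μ a * ∑' i : ℕ,
        if ((i * ε : ℚ≥0) : WithTop ℚ≥0) < a.2 then ((ε : ℝ≥0) : ℝ≥0∞) else 0 := by
  simp only [tail, ← ENNReal.tsum_mul_left, ← ENNReal.tsum_mul_right]
  rw [ENNReal.tsum_comm]
  simp only [ite_mul, mul_ite, zero_mul, mul_zero]

theorem expected_cost_le_grid (μ : PDist Val) {ε : ℚ≥0} (hε : 0 < ε) :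
    ∑' a, μ a * costE a.2 ≤
      ∑' i : ℕ, tail μ ((i * ε : ℚ≥0) : WithTop ℚ≥0) * ((ε : ℝ≥0) : ℝ≥0∞) := by
  rw [tsum_tail_mul]
  exact ENNReal.tsum_le_tsum fun a => mul_le_mul_right (costE_le_grid hε a.2) _

theorem grid_le_expected_cost {μ : PDist Val} (hμ : IsDist μ) {ε : ℚ≥0} (hε : 0 < ε) :
    ∑' i : ℕ, tail μ ((i * ε : ℚ≥0) : WithTop ℚ≥0) * ((ε : ℝ≥0) : ℝ≥0∞) ≤
      ∑' a, μ a * costE a.2 + ((ε : ℝ≥0) : ℝ≥0∞) := by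
  calc _ ≤ ∑' a, (μ a * costE a.2 + μ a * ((ε : ℝ≥0) : ℝ≥0∞)) := by
        rw [tsum_tail_mul]
        refine ENNReal.tsum_le_tsum fun a => ?_
        rw [← mul_add]
        exact mul_le_mul_right (grid_le_costE hε a.2) _
    _ = _ := by
        have h : ∑' a, μ a = 1 := hμ
        rw [ENNReal.tsum_add, ENNReal.tsum_mul_right, h, one_mul]

end

/-- **Bound preservation in the limit** (Lemma 5.6): for a chain
`μ₁ ⊑ μ₂ ⊑ ⋯` of distributions and `M ∈ ℝ≥0`, if `h(μₙ) ≤ M` for all `n`,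
then `h(⊔_{n∈ℕ} μₙ) ≤ M`. -/
theorem hFn_le_of_chain (Val : Type*) [Countable Val]
    (Φ : Val → ℝ≥0) (M : ℝ≥0)
    (μs : ℕ → PDist Val) (hdist : ∀ n, IsDist (μs n))
    (hchain : ∀ n, DLE (μs n) (μs (n + 1)))
    (hbound : ∀ n, hFn Φ (μs n) ≤ (M : ℝ≥0∞))
    (μ : PDist Val) (hμ : IsDist μ) (hub : ∀ n, DLE (μs n) μ)
    (hlub : ∀ ν : PDist Val, IsDist ν → (∀ n, DLE (μs n) ν) → DLE μ ν) :
    hFn Φ μ ≤ (M : ℝ≥0∞) := by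
  have hmono : Monotone fun n => potential Φ (μs n) := fun m n h =>
    potential_mono Φ fun v c => DLE.of_chain hchain h |>.1 v c
  have hpot : potential Φ μ ≤ ⨆ n, potential Φ (μs n) := by
    rw [← potential_iSup Φ hchain]
    exact potential_mono Φ (le_iSup_of_lub hdist hchain hlub)
  refine ENNReal.le_of_forall_pos_le_add fun δ hδ _ => ?_
  obtain ⟨ε, hε, hεδ⟩ : ∃ ε : ℚ≥0, 0 < ε ∧ ((ε : ℝ≥0) : ℝ≥0∞) ≤ δ := by
    obtain ⟨k, hk⟩ := exists_nat_one_div_lt (K := ℝ≥0) hδ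
    refine ⟨1 / ((k : ℚ≥0) + 1), by positivity, ?_⟩
    have : ((1 / ((k : ℚ≥0) + 1) : ℚ≥0) : ℝ≥0) = 1 / ((k : ℝ≥0) + 1) := by push_cast; rfl
    rw [this]
    exact_mod_cast hk.le
  calc hFn Φ μ
      ≤ potential Φ μ + ∑' i : ℕ, tail μ ((i * ε : ℚ≥0) : WithTop ℚ≥0) * ((ε : ℝ≥0) : ℝ≥0∞) := by
        rw [hFn_eq]
        exact add_le_add_right (expected_cost_le_grid μ hε) _
    _ ≤ (⨆ n, potential Φ (μs n)) +
          ⨆ n, ∑' i : ℕ, tail (μs n) ((i * ε : ℚ≥0) : WithTop ℚ≥0) * ((ε : ℝ≥0) : ℝ≥0∞) := by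
        refine add_le_add hpot ?_
        rw [← tsum_iSup_of_monotone (f := fun (i : ℕ) n =>
          tail (μs n) ((i * ε : ℚ≥0) : WithTop ℚ≥0) * ((ε : ℝ≥0) : ℝ≥0∞)) fun i m n h =>
          mul_le_mul_left (tail_mono (hdist m) (hdist n) (DLE.of_chain hchain h) _) _]
        refine ENNReal.tsum_le_tsum fun i => ?_
        rw [← ENNReal.iSup_mul]
        exact mul_le_mul_left (tail_le_iSup_of_lub hdist hchain hμ hlub _) _
    _ = ⨆ n, (potential Φ (μs n) +
          ∑' i : ℕ, tail (μs n) ((i * ε : ℚ≥0) : WithTop ℚ≥0) * ((ε : ℝ≥0) : ℝ≥0∞)) :=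
        ENNReal.iSup_add_iSup_of_monotone hmono fun m n h =>
          ENNReal.tsum_le_tsum fun i => mul_le_mul_left
            (tail_mono (hdist m) (hdist n) (DLE.of_chain hchain h) _) _
    _ ≤ M + δ := by
        refine iSup_le fun n => ?_
        calc _ ≤ hFn Φ (μs n) + ((ε : ℝ≥0) : ℝ≥0∞) := by
              rw [hFn_eq, add_assoc]
              exact add_le_add_right (grid_le_expected_cost (hdist n) hε) _
          _ ≤ M + δ := add_le_add (hbound n) hεδ

end
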